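/- For every weighted graph G = (V,E) with edge weights w : E → ℝ≥0 and every vertex v ∈ V, the deletion of v decreases γ by at most one: γ(G∖v) ≥ γ(G) − 1. -/

import Mathlib

namespace Stabilizer

variable {V : Type*} [Fintype V] [DecidableEq V]

/-- The set of vertices covered by a finite set of edges. -/
def edgeVerts (C : Finset (Sym2 V)) : Set V := {v | ∃ e ∈ C, v ∈ e}

/-- A matching of `G`, given as a finite set of pairwise vertex-disjoint edges. -/
def IsMatching (G : SimpleGraph V) (M : Finset (Sym2 V)) : Prop :=
  (↑M ⊆ G.edgeSet) ∧ ∀ e ∈ M, ∀ f ∈ M, e ≠ f → ∀ v : V, v ∈ e → v ∉ f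

/-- The total weight of a finite set of edges. -/
noncomputable def setWeight (w : Sym2 V → ℝ) (M : Finset (Sym2 V)) : ℝ := ∑ e ∈ M, w e

/-- ν(G): the maximum weight of a matching of `G`. -/
noncomputable def nu (G : SimpleGraph V) (w : Sym2 V → ℝ) : ℝ :=
  sSup {r : ℝ | ∃ M : Finset (Sym2 V), IsMatching G M ∧ r = setWeight w M}

/-- A fractional matching of `G`. -/
def IsFracMatching (G : SimpleGraph V) (x : Sym2 V → ℝ) : Prop :=
  (∀ e, 0 ≤ x e) ∧ (∀ e, e ∉ G.edgeSet → x e = 0) ∧ ∀ v : V, ∑ u : V, x s(v, u) ≤ 1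

/-- The weight of a fractional matching. -/
noncomputable def fracWeight (w x : Sym2 V → ℝ) : ℝ := ∑ e : Sym2 V, w e * x e

/-- ν_f(G): the maximum weight of a fractional matching of `G`. -/
noncomputable def nuf (G : SimpleGraph V) (w : Sym2 V → ℝ) : ℝ :=
  sSup {r : ℝ | ∃ x : Sym2 V → ℝ, IsFracMatching G x ∧ r = fracWeight w x}

/-- A maximum-weight fractional matching of `G`. -/
def IsMaxFracMatching (G : SimpleGraph V) (w x : Sym2 V → ℝ) : Prop :=
  IsFracMatching G x ∧ ∀ y : Sym2 V → ℝ, IsFracMatching G y → fracWeight w y ≤ fracWeight w x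

/-- All entries lie in {0, 1/2, 1}. -/
def IsHalfIntegral (x : Sym2 V → ℝ) : Prop := ∀ e, x e = 0 ∨ x e = 1 / 2 ∨ x e = 1

/-- `C` is the edge set of an odd cycle of `G`. -/
def IsOddCycleEdgeSet (G : SimpleGraph V) (C : Finset (Sym2 V)) : Prop :=
  ∃ (v : V) (c : G.Walk v v), c.IsCycle ∧ Odd c.length ∧ c.edges.toFinset = C

/-- `F` is the family 𝒞(x) of vertex-disjoint odd cycles carrying exactly the
half-valued edges of `x`. -/
def IsCycleFamily (G : SimpleGraph V) (x : Sym2 V → ℝ) (F : Finset (Finset (Sym2 V))) : Prop :=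
  (∀ C ∈ F, IsOddCycleEdgeSet G C) ∧
  (∀ C ∈ F, ∀ D ∈ F, C ≠ D → Disjoint (edgeVerts C) (edgeVerts D)) ∧
  (∀ e : Sym2 V, x e = 1 / 2 ↔ ∃ C ∈ F, e ∈ C)

/-- A basic fractional matching of `G`. -/
def IsBasic (G : SimpleGraph V) (x : Sym2 V → ℝ) : Prop :=
  IsFracMatching G x ∧ IsHalfIntegral x ∧ ∃ F, IsCycleFamily G x F

/-- γ(G): the minimum number of odd cycles in the support of a basic
maximum-weight fractional matching of `G`. -/
noncomputable def gamma (G : SimpleGraph V) (w : Sym2 V → ℝ) : ℕ :=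
  sInf {n : ℕ | ∃ (x : Sym2 V → ℝ) (F : Finset (Finset (Sym2 V))),
    IsMaxFracMatching G w x ∧ IsHalfIntegral x ∧ IsCycleFamily G x F ∧ F.card = n}

/-- `G` is stable: ν(G) = ν_f(G). -/
def IsStable (G : SimpleGraph V) (w : Sym2 V → ℝ) : Prop := nu G w = nuf G w

/-- Deletion of a set of vertices (as the spanning subgraph obtained by
removing all edges incident to `S`; matchings, fractional matchings and covers
of `G∖S` correspond to those of this graph). -/
def deleteVerts (G : SimpleGraph V) (S : Set V) : SimpleGraph V where
  Adj a b := G.Adj a b ∧ a ∉ S ∧ b ∉ S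
  symm := ⟨fun _ _ h => ⟨h.1.symm, h.2.2, h.2.1⟩⟩
  loopless := ⟨fun a h => G.loopless.irrefl a h.1⟩

/-- A fractional w-vertex cover of `G`. -/
def IsFracCover (G : SimpleGraph V) (w : Sym2 V → ℝ) (y : V → ℝ) : Prop :=
  (∀ v, 0 ≤ y v) ∧ ∀ a b : V, G.Adj a b → w s(a, b) ≤ y a + y b

noncomputable def coverValue (y : V → ℝ) : ℝ := ∑ v : V, y v

/-- A minimum fractional w-vertex cover of `G`. -/
def IsMinFracCover (G : SimpleGraph V) (w : Sym2 V → ℝ) (y : V → ℝ) : Prop :=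
  IsFracCover G w y ∧ ∀ z : V → ℝ, IsFracCover G w z → coverValue y ≤ coverValue z

/-- M(x): the 1-valued edges of `x`. -/
noncomputable def oneEdges (x : Sym2 V → ℝ) : Finset (Sym2 V) :=
  Finset.univ.filter fun e => x e = 1

/-- `v` is exposed by the matching `M`. -/
def MExposed (M : Finset (Sym2 V)) (v : V) : Prop := ∀ e ∈ M, v ∉ e

/-- A list of edges alternately in and out of `M`. -/
def AltList (M : Finset (Sym2 V)) (l : List (Sym2 V)) : Prop :=
  l.Chain' fun e f => (e ∈ M ↔ f ∉ M)

variable {G : SimpleGraph V}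

/-- An M-alternating walk. -/
def IsAltWalk (M : Finset (Sym2 V)) {a b : V} (p : G.Walk a b) : Prop := AltList M p.edges

/-- A valid walk: it starts (resp. ends) with an M-exposed vertex or an edge of `M`. -/
def IsValidWalk (M : Finset (Sym2 V)) {a b : V} (p : G.Walk a b) : Prop :=
  (MExposed M a ∨ ∃ e ∈ M, p.edges.head? = some e) ∧
  (MExposed M b ∨ ∃ e ∈ M, p.edges.getLast? = some e)

/-- w(P ∩ M), with multiplicity. -/
noncomputable def wIn (w : Sym2 V → ℝ) (M : Finset (Sym2 V)) (l : List (Sym2 V)) : ℝ :=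
  (l.map fun e => if e ∈ M then w e else 0).sum

/-- w(P ∖ M), with multiplicity. -/
noncomputable def wOut (w : Sym2 V → ℝ) (M : Finset (Sym2 V)) (l : List (Sym2 V)) : ℝ :=
  (l.map fun e => if e ∈ M then 0 else w e).sum

/-- An M-augmenting walk. -/
def IsAugWalk (w : Sym2 V → ℝ) (M : Finset (Sym2 V)) {a b : V} (p : G.Walk a b) : Prop :=
  IsAltWalk M p ∧ IsValidWalk M p ∧ wIn w M p.edges < wOut w M p.edges

/-- An M-augmenting path. -/
def IsAugPath (w : Sym2 V → ℝ) (M : Finset (Sym2 V)) {a b : V} (p : G.Walk a b) : Prop :=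
  p.IsPath ∧ IsAugWalk w M p

/-- An M-alternating cycle (an even cycle alternately in and out of `M`). -/
def IsAltCycle (M : Finset (Sym2 V)) {a : V} (c : G.Walk a a) : Prop :=
  c.IsCycle ∧ Even c.length ∧ AltList M c.edges ∧
  ∀ e f : Sym2 V, c.edges.head? = some e → c.edges.getLast? = some f → (e ∈ M ↔ f ∉ M)

/-- An M-augmenting cycle. -/
def IsAugCycle (w : Sym2 V → ℝ) (M : Finset (Sym2 V)) {a : V} (c : G.Walk a a) : Prop :=
  IsAltCycle M c ∧ wIn w M c.edges < wOut w M c.edges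

/-- An M-blossom with base `a` (traversed starting and ending at its base). -/
def IsBlossom (M : Finset (Sym2 V)) {a : V} (c : G.Walk a a) : Prop :=
  c.IsCycle ∧ Odd c.length ∧ AltList M c.edges ∧
  ∀ e : Sym2 V, c.edges.head? = some e → e ∉ M

/-- An M-flower: an M-blossom `c` with base `a` together with a valid M-alternating
path `p` from the base `a` to the root `r`, starting with an edge of `M`. -/
def IsFlower (M : Finset (Sym2 V)) {a r : V} (c : G.Walk a a) (p : G.Walk a r) : Prop :=
  IsBlossom M c ∧ p.IsPath ∧ AltList M p.edges ∧
  (∃ e ∈ M, p.edges.head? = some e) ∧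
  (MExposed M r ∨ ∃ e ∈ M, p.edges.getLast? = some e)

/-- An M-augmenting flower (with root `r`). -/
def IsAugFlower (w : Sym2 V → ℝ) (M : Finset (Sym2 V)) {a r : V}
    (c : G.Walk a a) (p : G.Walk a r) : Prop :=
  IsFlower M c p ∧
  wIn w M c.edges + 2 * wIn w M p.edges < wOut w M c.edges + 2 * wOut w M p.edges

/-- An M-bi-cycle: two M-blossoms `c`, `d` with bases `a`, `b` joined by an odd
M-alternating path `p` starting and ending with edges of `M`. -/
def IsBicycle (M : Finset (Sym2 V)) {a b : V}
    (c : G.Walk a a) (p : G.Walk a b) (d : G.Walk b b) : Prop :=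
  IsBlossom M c ∧ IsBlossom M d ∧ p.IsPath ∧ Odd p.length ∧ AltList M p.edges ∧
  (∃ e ∈ M, p.edges.head? = some e) ∧ (∃ e ∈ M, p.edges.getLast? = some e)

/-- An M-augmenting bi-cycle. -/
def IsAugBicycle (w : Sym2 V → ℝ) (M : Finset (Sym2 V)) {a b : V}
    (c : G.Walk a a) (p : G.Walk a b) (d : G.Walk b b) : Prop :=
  IsBicycle M c p d ∧
  wIn w M c.edges + 2 * wIn w M p.edges + wIn w M d.edges <
    wOut w M c.edges + 2 * wOut w M p.edges + wOut w M d.edges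

/-- All edges of the walk are tight with respect to the fractional vertex cover `y`. -/
def IsTightWalk (w : Sym2 V → ℝ) (y : V → ℝ) {a b : V} (p : G.Walk a b) : Prop :=
  ∀ d ∈ p.darts, y d.toProd.1 + y d.toProd.2 = w s(d.toProd.1, d.toProd.2)

/-- `x'` is the result of alternate rounding on the odd cycle with edge set `C`
at the vertex `u`: on `C` it is 0/1-valued, both edges of `C` at `u` get value 0,
and its 1-valued edges inside `C` perfectly match the remaining vertices of `C`. -/
def AltRoundedOn (x' : Sym2 V → ℝ) (C : Finset (Sym2 V)) (u : V) : Prop :=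
  (∀ e ∈ C, x' e = 0 ∨ x' e = 1) ∧ (∀ e ∈ C, u ∈ e → x' e = 0) ∧
  ∀ z ∈ edgeVerts C, z ≠ u → ∃! e : Sym2 V, e ∈ C ∧ x' e = 1 ∧ z ∈ e

/-- The degree of the vertex `u` under the edge vector `x`. -/
def fracDeg (x : Sym2 V → ℝ) (u : V) : ℝ := ∑ b : V, x s(u, b)

/-- The symmetric matrix of an edge vector, with the slack of each vertex on the diagonal. -/
def fracMat (x : Sym2 V → ℝ) : Matrix V V ℝ :=
  fun u u' => if u = u' then 1 - fracDeg x u else x s(u, u')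

open Classical in
/-- The symmetrization of a permutation, restricted to the edges of `G`. -/
noncomputable def permFrac (G : SimpleGraph V) (σ : Equiv.Perm V) (e : Sym2 V) : ℝ :=
  if e ∈ G.edgeSet then ∑ u : V, if s(u, σ u) = e then (1 / 2 : ℝ) else 0 else 0

open Classical in
/-- The weight of a permutation, where pairs which are not edges of `G` have weight zero. -/
noncomputable def permWeight (G : SimpleGraph V) (w : Sym2 V → ℝ) (σ : Equiv.Perm V) : ℝ :=
  ∑ u : V, if s(u, σ u) ∈ G.edgeSet then w s(u, σ u) else 0

lemma IsFracMatching.eq_zero_diag {x : Sym2 V → ℝ} (hx : IsFracMatching G x) (u : V) :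
    x s(u, u) = 0 := hx.2.1 _ (by simp)

lemma IsFracMatching.fracDeg_le {x : Sym2 V → ℝ} (hx : IsFracMatching G x) (u : V) :
    fracDeg x u ≤ 1 := hx.2.2 u

lemma fracMat_mem {x : Sym2 V → ℝ} (hx : IsFracMatching G x) :
    fracMat x ∈ doublyStochastic ℝ V := by
  have key : ∀ u, ∑ b, fracMat x u b = 1 := by
    intro u
    have : ∀ b, fracMat x u b = x s(u, b) + if u = b then 1 - fracDeg x u else 0 := by
      intro b
      unfold fracMat
      split_ifs with h
      · subst h; simp [hx.eq_zero_diag]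
      · simp
    simp only [this, Finset.sum_add_distrib, Finset.sum_ite_eq, Finset.mem_univ, if_true]
    simp [fracDeg]
  have symm : ∀ a b, fracMat x a b = fracMat x b a := by
    intro a b
    unfold fracMat
    by_cases h : a = b
    · subst h; rfl
    · rw [if_neg h, if_neg (Ne.symm h), Sym2.eq_swap]
  rw [mem_doublyStochastic_iff_sum]
  refine ⟨fun a b => ?_, key, fun b => ?_⟩
  · unfold fracMat
    split_ifs
    · linarith [hx.fracDeg_le a]
    · exact hx.1 _
  · rw [← key b]
    exact Finset.sum_congr rfl fun a _ => symm a b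

/-- A linear functional on doubly stochastic matrices is bounded by its values at permutations. -/
lemma sum_mul_le_of_doublyStochastic {c : V → V → ℝ} {B : ℝ}
    (hB : ∀ σ : Equiv.Perm V, ∑ u, c u (σ u) ≤ B) {M : Matrix V V ℝ}
    (hM : M ∈ doublyStochastic ℝ V) : ∑ u, ∑ b, c u b * M u b ≤ B := by
  obtain ⟨l, hl0, hl1, rfl⟩ := exists_eq_sum_perm_of_mem_doublyStochastic hM
  have : ∑ u, ∑ b, c u b * (∑ σ, l σ • σ.permMatrix ℝ) u b
      = ∑ σ : Equiv.Perm V, l σ * ∑ u, c u (σ u) := by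
    simp only [Matrix.sum_apply, Matrix.smul_apply, Finset.mul_sum, smul_eq_mul,
      PEquiv.toMatrix_apply, Equiv.toPEquiv_apply, Option.mem_def, Option.some.injEq]
    simp_rw [Finset.sum_comm (s := (Finset.univ : Finset V))
      (t := (Finset.univ : Finset (Equiv.Perm V)))]
    refine Finset.sum_congr rfl fun σ _ => Finset.sum_congr rfl fun u _ => ?_
    simp only [mul_ite, mul_one, mul_zero, Finset.sum_ite_eq, Finset.mem_univ, if_true]
    ring
  rw [this]
  calc _ ≤ ∑ σ : Equiv.Perm V, l σ * B :=
        Finset.sum_le_sum fun σ _ => mul_le_mul_of_nonneg_left (hB σ) (hl0 σ)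
    _ = B := by rw [← Finset.sum_mul, hl1, one_mul]

lemma sum_sum_sym2 (f : Sym2 V → ℝ) (hf : ∀ u, f s(u, u) = 0) :
    ∑ u, ∑ b, f s(u, b) = 2 * ∑ e, f e := by
  have h1 : ∀ u b, f s(u, b) = ∑ e : Sym2 V, if s(u, b) = e then f e else 0 := by simp
  simp_rw [h1]
  rw [← Finset.sum_product' (f := fun u b => ∑ e : Sym2 V, if s(u, b) = e then f e else 0),
    Finset.sum_comm, Finset.mul_sum]
  refine Finset.sum_congr rfl fun e _ => ?_
  induction e with | _ a b
  by_cases h : a = b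
  · subst h; simp [hf]
  · rw [← Finset.sum_filter, Finset.sum_const,
      show (Finset.univ ×ˢ Finset.univ : Finset (V × V)).filter (fun p => s(p.1, p.2) = s(a, b))
        = {(a, b), (b, a)} by ext ⟨c, d⟩; simp]
    rw [Finset.card_pair (by simp [h])]
    simp

open Classical in
lemma two_mul_fracWeight {x : Sym2 V → ℝ} (hx : IsFracMatching G x) (w : Sym2 V → ℝ) :
    2 * fracWeight w x
      = ∑ u, ∑ b, (if s(u, b) ∈ G.edgeSet then w s(u, b) else 0) * fracMat x u b := by
  unfold fracWeight
  rw [← sum_sum_sym2 _ fun u => by rw [hx.eq_zero_diag, mul_zero]]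
  refine Finset.sum_congr rfl fun u _ => Finset.sum_congr rfl fun b _ => ?_
  by_cases h : s(u, b) ∈ G.edgeSet
  · have : u ≠ b := by rintro rfl; simp at h
    rw [if_pos h, fracMat, if_neg this]
  · rw [hx.2.1 _ h, if_neg h]; ring

lemma fracDeg_permFrac_le (σ : Equiv.Perm V) (a : V) : fracDeg (permFrac G σ) a ≤ 1 := by
  classical
  have h1 : ∀ b, permFrac G σ s(a, b)
      ≤ ∑ u, ((if u = a ∧ σ u = b then (1 / 2 : ℝ) else 0)
        + if σ u = a ∧ u = b then (1 / 2 : ℝ) else 0) := by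
    intro b
    unfold permFrac
    split_ifs
    · refine Finset.sum_le_sum fun u _ => ?_
      simp only [Sym2.eq_iff]
      split_ifs <;> first | tauto | norm_num
    · exact Finset.sum_nonneg fun u _ => by positivity
  have h2 : ∀ b, ∑ u, ((if u = a ∧ σ u = b then (1 / 2 : ℝ) else 0)
      + if σ u = a ∧ u = b then (1 / 2 : ℝ) else 0)
      = (if σ a = b then 1 / 2 else 0) + if σ b = a then 1 / 2 else 0 := by
    intro b
    rw [Finset.sum_add_distrib]
    congr 1
    · simp [ite_and]
    · simp [ite_and, and_comm (a := σ _ = a)]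
  refine (Finset.sum_le_sum fun b _ => h1 b).trans ?_
  simp only [h2, Finset.sum_add_distrib, Finset.sum_ite_eq, Finset.mem_univ, if_true]
  simp only [σ.apply_eq_iff_eq_symm_apply]
  simp only [Finset.sum_ite_eq', Finset.mem_univ, if_true]
  norm_num

lemma fracDeg_permFrac_le_half {σ : Equiv.Perm V} {a : V} (ha : ¬ G.Adj a (σ a)) :
    fracDeg (permFrac G σ) a ≤ 1 / 2 := by
  classical
  have h1 : ∀ b, permFrac G σ s(a, b)
      ≤ ∑ u, if b = u then (if σ u = a then (1 / 2 : ℝ) else 0) else 0 := by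
    intro b
    unfold permFrac
    split_ifs with h
    · refine Finset.sum_le_sum fun u _ => ?_
      simp only [Sym2.eq_iff]
      split_ifs with h1 h2 h3 <;> try norm_num
      · obtain ⟨rfl, rfl⟩ | ⟨rfl, rfl⟩ := h1
        · exact ha h
        · tauto
      · obtain ⟨rfl, rfl⟩ | ⟨rfl, rfl⟩ := h1
        · exact ha h
        · tauto
    · exact Finset.sum_nonneg fun u _ => by positivity
  refine (Finset.sum_le_sum fun b _ => h1 b).trans ?_
  rw [Finset.sum_comm]
  simp only [Finset.sum_ite_eq', Finset.mem_univ, if_true, ← σ.eq_symm_apply]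
  norm_num

lemma permFrac_isFracMatching (σ : Equiv.Perm V) : IsFracMatching G (permFrac G σ) := by
  classical
  refine ⟨fun e => ?_, fun e he => by rw [permFrac, if_neg he], fun a => fracDeg_permFrac_le σ a⟩
  unfold permFrac
  split_ifs
  · exact Finset.sum_nonneg fun u _ => by positivity
  · rfl

lemma permFrac_pos {σ : Equiv.Perm V} {a : V} (ha : G.Adj a (σ a)) :
    0 < permFrac G σ s(a, σ a) := by
  classical
  rw [permFrac, if_pos (by simpa using ha)]
  exact Finset.sum_pos' (fun u _ => by positivity) ⟨a, Finset.mem_univ _, by simp⟩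

lemma two_mul_fracWeight_permFrac (w : Sym2 V → ℝ) (σ : Equiv.Perm V) :
    2 * fracWeight w (permFrac G σ) = permWeight G w σ := by
  classical
  have h1 : ∀ e, w e * permFrac G σ e
      = ∑ u, if s(u, σ u) = e then (if e ∈ G.edgeSet then w e / 2 else 0) else 0 := by
    intro e
    unfold permFrac
    split_ifs
    · rw [Finset.mul_sum]
      exact Finset.sum_congr rfl fun u _ => by split_ifs <;> ring
    · simp
  unfold fracWeight permWeight
  simp_rw [h1]
  rw [Finset.sum_comm, Finset.mul_sum]
  refine Finset.sum_congr rfl fun u _ => ?_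
  rw [Finset.sum_ite_eq]
  simp only [Finset.mem_univ, if_true]
  split_ifs <;> ring

/-- Some maximum-weight fractional matching is the symmetrization of a permutation. -/
lemma exists_permFrac_isMax (G : SimpleGraph V) (w : Sym2 V → ℝ) :
    ∃ σ : Equiv.Perm V, IsMaxFracMatching G w (permFrac G σ) := by
  classical
  obtain ⟨σ, -, hσ⟩ := Finset.exists_max_image Finset.univ (permWeight G w) Finset.univ_nonempty
  refine ⟨σ, permFrac_isFracMatching σ, fun y hy => ?_⟩
  have h1 : 2 * fracWeight w y ≤ permWeight G w σ := by
    rw [two_mul_fracWeight hy]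
    exact sum_mul_le_of_doublyStochastic (fun τ => hσ τ (Finset.mem_univ _)) (fracMat_mem hy)
  linarith [two_mul_fracWeight_permFrac (G := G) w σ]

lemma deleteVerts_le (S : Set V) : deleteVerts G S ≤ G := fun _ _ h => h.1

lemma IsFracMatching.mono {H : SimpleGraph V} (h : H ≤ G) {x : Sym2 V → ℝ}
    (hx : IsFracMatching H x) : IsFracMatching G x :=
  ⟨hx.1, fun e he => hx.2.1 e fun h' => he (SimpleGraph.edgeSet_mono h h'), hx.2.2⟩

lemma fracDeg_deleteVerts {x : Sym2 V → ℝ} {v : V}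
    (hx : IsFracMatching (deleteVerts G {v}) x) : fracDeg x v = 0 :=
  Finset.sum_eq_zero fun b _ => hx.2.1 _ (by simp [deleteVerts])

lemma permFrac_isFracMatching_deleteVerts {σ : Equiv.Perm V} {v : V} (hσ : σ v = v) :
    IsFracMatching (deleteVerts G {v}) (permFrac G σ) := by
  classical
  refine ⟨(permFrac_isFracMatching σ).1, fun e he => ?_, fracDeg_permFrac_le σ⟩
  unfold permFrac
  split_ifs with h
  · induction e with | _ a b
    have hab : a = v ∨ b = v := by
      by_contra hc
      exact he (by simpa [deleteVerts, not_or.1 hc] using h)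
    have hne : a ≠ b := by rintro rfl; simp at h
    refine Finset.sum_eq_zero fun u _ => if_neg fun hu => ?_
    have hinj := σ.injective
    rcases hab with rfl | rfl <;> rcases Sym2.eq_iff.1 hu with ⟨rfl, h2⟩ | ⟨rfl, h2⟩
    · exact hne (hσ.symm.trans h2)
    · exact hne (hinj (hσ.trans h2.symm))
    · exact hne (hinj (h2.trans hσ.symm))
    · exact hne (h2.symm.trans hσ)
  · rfl

/-- If a nonnegative matrix is supported in the positive entries of another one, some positive
multiple of it is dominated by the other. -/
lemma exists_pos_mul_le {M N : V → V → ℝ} (hM : ∀ a b, 0 ≤ M a b) (hN : ∀ a b, 0 ≤ N a b)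
    (h : ∀ a b, 0 < M a b → 0 < N a b) : ∃ ε : ℝ, 0 < ε ∧ ∀ a b, ε * M a b ≤ N a b := by
  have : ∀ᶠ ε in nhdsWithin (0 : ℝ) (Set.Ioi 0), ∀ a b, ε * M a b ≤ N a b := by
    refine Filter.eventually_all.2 fun a => Filter.eventually_all.2 fun b => ?_
    rcases (hM a b).eq_or_lt with h0 | h0
    · rw [← h0]; simp [hN]
    · have ht : Filter.Tendsto (fun ε : ℝ => ε * M a b) (nhdsWithin 0 (Set.Ioi 0)) (nhds 0) := by
        have : ContinuousAt (fun ε : ℝ => ε * M a b) 0 := by fun_prop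
        simpa [ContinuousAt] using this.tendsto.mono_left nhdsWithin_le_nhds
      exact (ht.eventually_lt_const (h a b h0)).mono fun _ h => h.le
  obtain ⟨ε, h1, h2⟩ := (this.and self_mem_nhdsWithin).exists
  exact ⟨ε, h2, h1⟩

open Classical in
/-- The slack at `v` may be charged with the drop of the optimum caused by deleting `v`. -/
lemma exists_sum_mul_le {w : Sym2 V → ℝ} {v : V} {x z : Sym2 V → ℝ}
    (hx : IsMaxFracMatching (deleteVerts G {v}) w x) (hz : IsMaxFracMatching G w z) :
    ∃ c : V → V → ℝ,
      (∀ y, IsFracMatching G y → ∑ u, ∑ b, c u b * fracMat y u b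
        = 2 * fracWeight w y + 2 * (fracWeight w z - fracWeight w x) * (1 - fracDeg y v)) ∧
      ∀ M ∈ doublyStochastic ℝ V, ∑ u, ∑ b, c u b * M u b ≤ 2 * fracWeight w z := by
  set t : ℝ := 2 * (fracWeight w z - fracWeight w x) with ht
  set c : V → V → ℝ := fun u b =>
    (if s(u, b) ∈ G.edgeSet then w s(u, b) else 0) + if u = v ∧ b = v then t else 0 with hc
  refine ⟨c, fun y hy => ?_, fun M hM => sum_mul_le_of_doublyStochastic (fun σ => ?_) hM⟩
  · rw [two_mul_fracWeight hy w]
    simp only [hc, add_mul, Finset.sum_add_distrib, ite_and, ite_mul, zero_mul]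
    congr 1
    rw [Finset.sum_eq_single v]
    · simp [fracMat]
    · intro b _ hb; simp [hb]
    · simp
  · have h1 : ∑ u, c u (σ u) = permWeight G w σ + if σ v = v then t else 0 := by
      simp only [hc, Finset.sum_add_distrib, permWeight, ite_and, Finset.sum_ite_eq',
        Finset.mem_univ, if_true]
    rw [h1, ← two_mul_fracWeight_permFrac]
    split_ifs with h
    · linarith [hx.2 _ (permFrac_isFracMatching_deleteVerts (G := G) h)]
    · linarith [hz.2 _ (permFrac_isFracMatching (G := G) σ)]

/-- Unless a maximum-weight fractional matching of `G∖v` is maximum for `G`, every maximum-weight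
fractional matching of `G` saturates `v`. -/
lemma isMax_or_fracDeg_eq_one {w : Sym2 V → ℝ} {v : V} {x z : Sym2 V → ℝ}
    (hx : IsMaxFracMatching (deleteVerts G {v}) w x) (hz : IsMaxFracMatching G w z) :
    IsMaxFracMatching G w x ∨ fracDeg z v = 1 := by
  have hxG : IsFracMatching G x := hx.1.mono (deleteVerts_le _)
  obtain ⟨c, hval, hle⟩ := exists_sum_mul_le hx hz
  rcases (hz.1.fracDeg_le v).eq_or_lt with h | h
  · exact Or.inr h
  · left
    have h1 := hle _ (fracMat_mem hz.1)
    rw [hval _ hz.1] at h1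
    have h2 : fracWeight w z ≤ fracWeight w x := by nlinarith [hz.2 x hxG]
    exact ⟨hxG, fun y hy => (hz.2 y hy).trans h2⟩

/-- A fractional matching of `G` saturating `v` that is supported on edges and slack vertices of
optimal ones for `G∖v` and `G` is optimal. -/
lemma isMax_of_support {w : Sym2 V → ℝ} {v : V} {x z y : Sym2 V → ℝ}
    (hx : IsMaxFracMatching (deleteVerts G {v}) w x) (hz : IsMaxFracMatching G w z)
    (hy : IsFracMatching G y) (hyv : fracDeg y v = 1)
    (hsupp : ∀ e, 0 < y e → 0 < x e ∨ 0 < z e)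
    (hslack : ∀ u, fracDeg y u < 1 → fracDeg x u < 1 ∨ fracDeg z u < 1) :
    IsMaxFracMatching G w y := by
  have hxG : IsFracMatching G x := hx.1.mono (deleteVerts_le _)
  have ht0 : 0 ≤ 2 * (fracWeight w z - fracWeight w x) := by linarith [hz.2 x hxG]
  obtain ⟨c, hval, hle⟩ := exists_sum_mul_le hx hz
  have hmx := mem_doublyStochastic_iff_sum.1 (fracMat_mem hxG)
  have hmz := mem_doublyStochastic_iff_sum.1 (fracMat_mem hz.1)
  have hmy := mem_doublyStochastic_iff_sum.1 (fracMat_mem hy)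
  obtain ⟨ε, hε, hεle⟩ := exists_pos_mul_le (M := fracMat y)
    (N := fun a b => (fracMat x a b + fracMat z a b) / 2) hmy.1
    (fun a b => by linarith [hmx.1 a b, hmz.1 a b])
    (fun a b hab => by
      have : 0 < fracMat x a b ∨ 0 < fracMat z a b := by
        unfold fracMat at hab ⊢
        split_ifs at hab ⊢
        · simpa using hslack a (by linarith)
        · exact hsupp _ hab
      rcases this with h | h <;> linarith [hmx.1 a b, hmz.1 a b])
  have hD := hle ((1 + ε) • ((1 / 2 : ℝ) • (fracMat x + fracMat z)) - ε • fracMat y) (by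
    rw [mem_doublyStochastic_iff_sum]
    refine ⟨fun a b => ?_, fun a => ?_, fun b => ?_⟩
    · simp only [Matrix.sub_apply, Matrix.smul_apply, Matrix.add_apply, smul_eq_mul]
      have := mul_nonneg hε.le (add_nonneg (hmx.1 a b) (hmz.1 a b))
      linarith [hεle a b]
    · simp only [Matrix.sub_apply, Matrix.smul_apply, Matrix.add_apply, smul_eq_mul,
        Finset.sum_sub_distrib, Finset.sum_add_distrib, ← Finset.mul_sum, hmx.2.1, hmz.2.1,
        hmy.2.1]
      ring
    · simp only [Matrix.sub_apply, Matrix.smul_apply, Matrix.add_apply, smul_eq_mul,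
        Finset.sum_sub_distrib, Finset.sum_add_distrib, ← Finset.mul_sum, hmx.2.2, hmz.2.2,
        hmy.2.2]
      ring)
  have hlin : ∑ u, ∑ b, c u b *
      ((1 + ε) • ((1 / 2 : ℝ) • (fracMat x + fracMat z)) - ε • fracMat y) u b
      = (1 + ε) * (1 / 2 * (∑ u, ∑ b, c u b * fracMat x u b + ∑ u, ∑ b, c u b * fracMat z u b))
        - ε * ∑ u, ∑ b, c u b * fracMat y u b := by
    simp only [Matrix.sub_apply, Matrix.smul_apply, Matrix.add_apply, smul_eq_mul,
      Finset.mul_sum, ← Finset.sum_sub_distrib, ← Finset.sum_add_distrib]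
    refine Finset.sum_congr rfl fun u _ => Finset.sum_congr rfl fun b _ => ?_
    ring
  rw [hlin, hval _ hxG, hval _ hz.1, hval _ hy, fracDeg_deleteVerts hx.1, hyv] at hD
  have hzs := mul_nonneg ht0 (sub_nonneg.2 (hz.1.fracDeg_le v))
  have h3 : 2 * fracWeight w z ≤ 2 * fracWeight w y := by
    have h4 : ε * (2 * fracWeight w z) ≤ ε * (2 * fracWeight w y) := by
      nlinarith [mul_nonneg hε.le hzs]
    exact le_of_mul_le_mul_left h4 hε
  exact ⟨hy, fun y' hy' => (hz.2 y' hy').trans (by linarith)⟩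

/-- The number of times a walk traverses an edge. -/
def edgeCount {a b : V} (p : G.Walk a b) (e : Sym2 V) : ℝ := p.edges.count e

/-- The number of times a walk traverses an edge at its second, fourth, sixth, … step. -/
def altCount : {a b : V} → G.Walk a b → Sym2 V → ℝ
  | _, _, .nil => 0
  | _, _, .cons _ p => edgeCount p - altCount p

lemma fracDeg_add (x y : Sym2 V → ℝ) (u : V) : fracDeg (x + y) u = fracDeg x u + fracDeg y u := by
  simp [fracDeg, Finset.sum_add_distrib]

lemma fracDeg_sub (x y : Sym2 V → ℝ) (u : V) : fracDeg (x - y) u = fracDeg x u - fracDeg y u := by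
  simp [fracDeg, Finset.sum_sub_distrib]

lemma fracDeg_smul (r : ℝ) (x : Sym2 V → ℝ) (u : V) : fracDeg (r • x) u = r * fracDeg x u := by
  simp [fracDeg, Finset.mul_sum]

lemma fracDeg_single {a b : V} (h : a ≠ b) (u : V) :
    fracDeg (Pi.single s(a, b) 1) u = (if u = a then 1 else 0) + if u = b then 1 else 0 := by
  have : ∀ c, (Pi.single s(a, b) 1 : Sym2 V → ℝ) s(u, c)
      = (if c = b then if u = a then 1 else 0 else 0) + if c = a then if u = b then 1 else 0 else 0 := by
    intro c
    simp only [Pi.single_apply, Sym2.eq_iff]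
    split_ifs <;> first | (exfalso; grind) | norm_num
  simp [fracDeg, this, Finset.sum_add_distrib]

lemma le_fracDeg {x : Sym2 V → ℝ} (hx : ∀ e, 0 ≤ x e) (u b : V) : x s(u, b) ≤ fracDeg x u :=
  Finset.single_le_sum (f := fun b => x s(u, b)) (fun b _ => hx s(u, b)) (Finset.mem_univ b)

lemma eq_zero_of_fracDeg_eq_zero {x : Sym2 V → ℝ} (hx : ∀ e, 0 ≤ x e) {u : V}
    (hu : fracDeg x u = 0) (b : V) : x s(u, b) = 0 :=
  le_antisymm (hu ▸ le_fracDeg hx u b) (hx _)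

lemma edgeCount_cons {a b c : V} (h : G.Adj a b) (p : G.Walk b c) :
    edgeCount (.cons h p) = Pi.single s(a, b) 1 + edgeCount p := by
  ext e
  simp only [edgeCount, SimpleGraph.Walk.edges_cons, List.count_cons, Pi.add_apply, Pi.single_apply]
  by_cases h : e = s(a, b)
  · subst h; simp [add_comm]
  · simp [h, Ne.symm h]

lemma altCount_cons {a b c : V} (h : G.Adj a b) (p : G.Walk b c) :
    altCount (.cons h p) = edgeCount p - altCount p := rfl

lemma edgeCount_append {a b c : V} (p : G.Walk a b) (q : G.Walk b c) :
    edgeCount (p.append q) = edgeCount p + edgeCount q := by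
  ext e; simp [edgeCount]

lemma altCount_append {a b c : V} (p : G.Walk a b) (q : G.Walk b c) :
    altCount (p.append q)
      = altCount p + if Even p.length then altCount q else edgeCount q - altCount q := by
  induction p with
  | nil => simp [altCount]
  | cons h p ih =>
    rw [SimpleGraph.Walk.cons_append, altCount_cons, altCount_cons, ih, edgeCount_append,
      SimpleGraph.Walk.length_cons]
    by_cases hp : Even p.length <;>
      simp only [hp, Nat.even_add_one, not_true, not_false_iff, if_true, if_false] <;> abel

lemma fracDeg_edgeCount {a b : V} (p : G.Walk a b) (u : V) :
    fracDeg (edgeCount p) u = 2 * p.support.count u - (if u = a then 1 else 0)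
      - if u = b then 1 else 0 := by
  induction p with
  | nil =>
    simp only [edgeCount, fracDeg, SimpleGraph.Walk.edges_nil, List.count_nil,
      SimpleGraph.Walk.support_nil, List.count_singleton, beq_iff_eq, eq_comm (a := u)]
    split_ifs <;> simp
    norm_num
  | cons h p ih =>
    rw [edgeCount_cons, fracDeg_add, fracDeg_single h.ne, ih, SimpleGraph.Walk.support_cons,
      List.count_cons]
    simp only [beq_iff_eq, eq_comm (b := u)]
    push_cast
    ring

lemma fracDeg_altCount {a b : V} (p : G.Walk a b) (u : V) :
    fracDeg (altCount p) u = p.support.count u - (if u = a then 1 else 0)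
      - if Even p.length then 0 else if u = b then 1 else 0 := by
  induction p with
  | nil =>
    simp only [altCount, fracDeg,
      SimpleGraph.Walk.support_nil, List.count_singleton, beq_iff_eq, eq_comm (a := u)]
    split_ifs <;> simp_all
  | cons h p ih =>
    rw [altCount_cons, fracDeg_sub, fracDeg_edgeCount, ih, SimpleGraph.Walk.support_cons,
      List.count_cons, SimpleGraph.Walk.length_cons]
    simp only [beq_iff_eq, eq_comm (b := u), Nat.even_add_one]
    push_cast
    split_ifs <;> first | contradiction | ring

lemma edgeCount_of_notMem {a b : V} {p : G.Walk a b} {e : Sym2 V} (he : e ∉ p.edges) :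
    edgeCount p e = 0 := by
  simp [edgeCount, List.count_eq_zero_of_not_mem he]

lemma edgeCount_of_mem {a b : V} {p : G.Walk a b} (hp : p.IsTrail) {e : Sym2 V}
    (he : e ∈ p.edges) : edgeCount p e = 1 := by
  simp [edgeCount, hp.count_edges_eq_one he]

lemma altCount_of_notMem {a b : V} {p : G.Walk a b} {e : Sym2 V} (he : e ∉ p.edges) :
    altCount p e = 0 := by
  induction p with
  | nil => rfl
  | cons h p ih =>
    rw [SimpleGraph.Walk.edges_cons, List.mem_cons, not_or] at he
    simp [altCount_cons, ih he.2, edgeCount_of_notMem he.2]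

lemma altCount_eq_zero_or_one {a b : V} {p : G.Walk a b} (hp : p.IsTrail) (e : Sym2 V) :
    altCount p e = 0 ∨ altCount p e = 1 := by
  induction p with
  | nil => exact Or.inl rfl
  | cons h p ih =>
    rw [SimpleGraph.Walk.isTrail_cons] at hp
    by_cases he : e ∈ p.edges
    · rcases ih hp.1 with h | h <;> simp [altCount_cons, h, edgeCount_of_mem hp.1 he]
    · simp [altCount_cons, altCount_of_notMem he, edgeCount_of_notMem he]

/-- `x` is a basic fractional matching with cycle family `F`. -/
structure IsBasicWith (G : SimpleGraph V) (x : Sym2 V → ℝ) (F : Finset (Finset (Sym2 V))) :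
    Prop where
  frac : IsFracMatching G x
  half : IsHalfIntegral x
  family : IsCycleFamily G x F

/-- Exchange the two alternating classes of edges along a walk. -/
def flip {a b : V} (x : Sym2 V → ℝ) (p : G.Walk a b) : Sym2 V → ℝ :=
  x + edgeCount p - (2 : ℝ) • altCount p

/-- A path of even length whose edges have `x`-values `0, 1, 0, 1, …, 0, 1`. -/
structure IsFlipPath {a b : V} (x : Sym2 V → ℝ) (p : G.Walk a b) : Prop where
  isPath : p.IsPath
  even : Even p.length
  agree : ∀ e ∈ p.edges, x e = altCount p e

lemma flip_of_mem {a b : V} {x : Sym2 V → ℝ} {p : G.Walk a b} (hp : IsFlipPath x p)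
    {e : Sym2 V} (he : e ∈ p.edges) : flip x p e = 1 - x e := by
  simp only [flip, Pi.sub_apply, Pi.add_apply, Pi.smul_apply, smul_eq_mul,
    edgeCount_of_mem hp.isPath.isTrail he, ← hp.agree e he]
  ring

lemma flip_of_notMem {a b : V} {x : Sym2 V → ℝ} {p : G.Walk a b} {e : Sym2 V}
    (he : e ∉ p.edges) : flip x p e = x e := by
  simp [flip, edgeCount_of_notMem he, altCount_of_notMem he]

lemma fracDeg_flip {a b : V} {x : Sym2 V → ℝ} {p : G.Walk a b} (hp : Even p.length) (u : V) :
    fracDeg (flip x p) u = fracDeg x u + (if u = a then 1 else 0) - if u = b then 1 else 0 := by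
  rw [flip, fracDeg_sub, fracDeg_add, fracDeg_smul, fracDeg_edgeCount, fracDeg_altCount,
    if_pos hp]
  ring

lemma IsFlipPath.eq_zero_or_one {a b : V} {x : Sym2 V → ℝ} {p : G.Walk a b}
    (hp : IsFlipPath x p) {e : Sym2 V} (he : e ∈ p.edges) : x e = 0 ∨ x e = 1 := by
  rw [hp.agree e he]
  exact altCount_eq_zero_or_one hp.isPath.isTrail e

lemma IsBasicWith.flip {a b : V} {x : Sym2 V → ℝ} {F : Finset (Finset (Sym2 V))}
    (hx : IsBasicWith G x F) (ha : fracDeg x a = 0) {p : G.Walk a b} (hp : IsFlipPath x p) :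
    IsBasicWith G (flip x p) F ∧ fracDeg (Stabilizer.flip x p) b = 0 := by
  have hval : ∀ e, e ∈ p.edges ∧ (x e = 0 ∧ Stabilizer.flip x p e = 1
      ∨ x e = 1 ∧ Stabilizer.flip x p e = 0) ∨ e ∉ p.edges ∧ Stabilizer.flip x p e = x e := by
    intro e
    by_cases he : e ∈ p.edges
    · rcases hp.eq_zero_or_one he with h | h <;> simp [flip_of_mem hp he, h, he]
    · exact Or.inr ⟨he, flip_of_notMem he⟩
  have hnn : ∀ e, 0 ≤ Stabilizer.flip x p e := by
    intro e
    rcases hval e with ⟨-, ⟨-, h⟩ | ⟨-, h⟩⟩ | ⟨-, h⟩ <;> rw [h]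
    · norm_num
    · exact hx.frac.1 e
  have hdeg := fracDeg_flip (x := x) hp.even
  refine ⟨⟨⟨hnn, fun e he => ?_, fun u => ?_⟩, fun e => ?_, hx.family.1, hx.family.2.1,
    fun e => ?_⟩, ?_⟩
  · rw [flip_of_notMem fun h => he (p.edges_subset_edgeSet h), hx.frac.2.1 e he]
  · change fracDeg _ u ≤ 1
    rw [hdeg]
    by_cases h : u = a
    · subst h; rw [ha]; split_ifs <;> norm_num
    · rw [if_neg h]
      have := hx.frac.fracDeg_le u
      split_ifs <;> linarith
  · rcases hval e with ⟨-, ⟨-, h⟩ | ⟨-, h⟩⟩ | ⟨-, h⟩ <;> rw [h]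
    · simp
    · simp
    · exact hx.half e
  · rw [← hx.family.2.2]
    rcases hval e with ⟨-, ⟨h', h⟩ | ⟨h', h⟩⟩ | ⟨-, h⟩ <;> rw [h]
    · rw [h']; norm_num
    · rw [h']; norm_num
  · have h0 : 0 ≤ fracDeg (Stabilizer.flip x p) b := Finset.sum_nonneg fun c _ => hnn _
    rw [hdeg, if_pos rfl] at h0 ⊢
    by_cases h : b = a
    · subst h; simp [ha]
    · rw [if_neg h] at h0 ⊢
      linarith [hx.frac.fracDeg_le b]

/-- Matching two exposed vertices. -/
lemma IsBasicWith.add_edge {a b : V} {y : Sym2 V → ℝ} {F : Finset (Finset (Sym2 V))}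
    (hy : IsBasicWith G y F) (ha : fracDeg y a = 0) (hb : fracDeg y b = 0) (hab : G.Adj a b) :
    IsBasicWith G (y + Pi.single s(a, b) 1) F := by
  have h0 : y s(a, b) = 0 := eq_zero_of_fracDeg_eq_zero hy.frac.1 ha b
  have hval : ∀ e, e = s(a, b) ∧ y e = 0 ∧ (y + Pi.single s(a, b) (1 : ℝ) : Sym2 V → ℝ) e = 1
      ∨ e ≠ s(a, b) ∧ (y + Pi.single s(a, b) (1 : ℝ) : Sym2 V → ℝ) e = y e := by
    intro e
    by_cases he : e = s(a, b)
    · subst he; simp [h0]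
    · simp [he]
  refine ⟨⟨fun e => ?_, fun e he => ?_, fun u => ?_⟩, fun e => ?_, hy.family.1, hy.family.2.1,
    fun e => ?_⟩
  · rcases hval e with ⟨-, -, h⟩ | ⟨-, h⟩ <;> rw [h]
    · norm_num
    · exact hy.frac.1 e
  · rcases hval e with ⟨rfl, -, -⟩ | ⟨-, h⟩
    · exact absurd hab he
    · rw [h, hy.frac.2.1 e he]
  · change fracDeg _ u ≤ 1
    have := hab.ne
    rw [fracDeg_add, fracDeg_single hab.ne]
    by_cases h1 : u = a
    · subst h1; simp [ha, this]
    · by_cases h2 : u = b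
      · subst h2; simp [hb, this.symm]
      · simp [h1, h2, hy.frac.fracDeg_le u]
  · rcases hval e with ⟨-, -, h⟩ | ⟨-, h⟩ <;> rw [h]
    · simp
    · exact hy.half e
  · rw [← hy.family.2.2]
    rcases hval e with ⟨-, h', h⟩ | ⟨-, h⟩ <;> rw [h]
    rw [h']; norm_num

lemma mem_edgeVerts_toFinset_iff {a b : V} {p : G.Walk a b} (hp : ¬ p.Nil) {u : V} :
    u ∈ edgeVerts p.edges.toFinset ↔ u ∈ p.support := by
  rw [SimpleGraph.Walk.mem_support_iff_exists_mem_edges_of_not_nil hp]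
  simp [edgeVerts]

/-- Matching an exposed vertex to a vertex of one of the odd cycles, which is rounded there. -/
lemma IsBasicWith.round_cycle {a b : V} {y : Sym2 V → ℝ} {F : Finset (Finset (Sym2 V))}
    (hy : IsBasicWith G y F) (ha : fracDeg y a = 0) (hab : G.Adj a b)
    {C : Finset (Sym2 V)} (hC : C ∈ F) (hb : b ∈ edgeVerts C) :
    ∃ y', IsBasicWith G y' (F.erase C) ∧
      (∀ u, fracDeg y' u = fracDeg y u + if u = a then 1 else 0) ∧
      ∀ e, 0 < y' e → 0 < y e ∨ e = s(a, b) := by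
  obtain ⟨r, c₀, hc₀, hodd₀, rfl⟩ := hy.family.1 C hC
  rw [mem_edgeVerts_toFinset_iff hc₀.not_nil] at hb
  obtain ⟨c, hc, hodd, hcE⟩ : ∃ c : G.Walk b b, c.IsCycle ∧ Odd c.length ∧
      c.edges.toFinset = c₀.edges.toFinset :=
    ⟨c₀.rotate b hb, hc₀.rotate hb, by simpa using hodd₀,
      List.toFinset_eq_of_perm _ _ (c₀.rotate_edges b hb).perm⟩
  rw [← hcE] at hC ⊢
  have hhalf : ∀ e ∈ c.edges, y e = 1 / 2 := fun e he =>
    (hy.family.2.2 e).2 ⟨_, hC, List.mem_toFinset.2 he⟩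
  have h0 : y s(a, b) = 0 := eq_zero_of_fracDeg_eq_zero hy.frac.1 ha b
  set y' : Sym2 V → ℝ := y - (1 / 2 : ℝ) • edgeCount c + altCount c + Pi.single s(a, b) 1 with hy'
  have hval : ∀ e, e ∈ c.edges ∧ e ≠ s(a, b) ∧ (y' e = 0 ∨ y' e = 1) ∨
      e ∉ c.edges ∧ e = s(a, b) ∧ y' e = 1 ∨ e ∉ c.edges ∧ e ≠ s(a, b) ∧ y' e = y e := by
    intro e
    by_cases he : e ∈ c.edges
    · have hne : e ≠ s(a, b) := by
        rintro rfl
        rw [hhalf _ he] at h0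
        norm_num at h0
      left
      refine ⟨he, hne, ?_⟩
      simp only [hy', Pi.add_apply, Pi.sub_apply, Pi.smul_apply, smul_eq_mul,
        edgeCount_of_mem hc.isTrail he, hhalf e he, Pi.single_eq_of_ne hne]
      simpa using altCount_eq_zero_or_one hc.isTrail e
    · right
      by_cases hne : e = s(a, b)
      · left
        refine ⟨he, hne, ?_⟩
        subst hne
        simp [hy', edgeCount_of_notMem he, altCount_of_notMem he, h0]
      · right
        refine ⟨he, hne, ?_⟩
        simp [hy', edgeCount_of_notMem he, altCount_of_notMem he, hne]
  have hdeg : ∀ u, fracDeg y' u = fracDeg y u + if u = a then 1 else 0 := by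
    intro u
    rw [hy', fracDeg_add, fracDeg_add, fracDeg_sub, fracDeg_smul, fracDeg_edgeCount,
      fracDeg_altCount, fracDeg_single hab.ne, if_neg (Nat.not_even_iff_odd.2 hodd)]
    ring
  refine ⟨y', ⟨⟨fun e => ?_, fun e he => ?_, fun u => ?_⟩, fun e => ?_,
    fun D hD => hy.family.1 D (Finset.mem_of_mem_erase hD),
    fun D hD E hE => hy.family.2.1 D (Finset.mem_of_mem_erase hD) E (Finset.mem_of_mem_erase hE),
    fun e => ?_⟩, hdeg, fun e he => ?_⟩
  · rcases hval e with ⟨-, -, h | h⟩ | ⟨-, -, h⟩ | ⟨-, -, h⟩ <;> rw [h]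
    · norm_num
    · norm_num
    · exact hy.frac.1 e
  · rcases hval e with ⟨h, -, -⟩ | ⟨-, rfl, -⟩ | ⟨-, -, h⟩
    · exact absurd (c.edges_subset_edgeSet h) he
    · exact absurd hab he
    · rw [h, hy.frac.2.1 e he]
  · change fracDeg _ u ≤ 1
    rw [hdeg]
    split_ifs with h
    · subst h; rw [ha]; norm_num
    · linarith [hy.frac.fracDeg_le u]
  · rcases hval e with ⟨-, -, h | h⟩ | ⟨-, -, h⟩ | ⟨-, -, h⟩ <;> rw [h]
    · simp
    · simp
    · simp
    · exact hy.half e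
  · have hC' : ∀ D ∈ F, e ∈ D → e ∈ c.edges → D = c.edges.toFinset := by
      intro D hD heD hec
      by_contra hne
      have hdisj := hy.family.2.1 D hD _ hC hne
      induction e with | _ u t
      exact Set.disjoint_left.1 hdisj (show u ∈ edgeVerts D from ⟨_, heD, by simp⟩)
        ⟨_, List.mem_toFinset.2 hec, by simp⟩
    constructor
    · intro h
      rcases hval e with ⟨-, -, h' | h'⟩ | ⟨-, -, h'⟩ | ⟨he, -, h'⟩
      · rw [h'] at h; norm_num at h
      · rw [h'] at h; norm_num at h
      · rw [h'] at h; norm_num at h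
      · rw [h'] at h
        obtain ⟨D, hD, heD⟩ := (hy.family.2.2 e).1 h
        refine ⟨D, Finset.mem_erase.2 ⟨?_, hD⟩, heD⟩
        rintro rfl
        exact he (List.mem_toFinset.1 heD)
    · rintro ⟨D, hD, heD⟩
      obtain ⟨hne, hD⟩ := Finset.mem_erase.1 hD
      have hye : y e = 1 / 2 := (hy.family.2.2 e).2 ⟨D, hD, heD⟩
      rcases hval e with ⟨h, -⟩ | ⟨-, rfl, -⟩ | ⟨-, -, h⟩
      · exact absurd (hC' D hD heD h) hne
      · rw [h0] at hye; norm_num at hye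
      · rw [h, hye]
  · rcases hval e with ⟨h, -, -⟩ | ⟨-, h, -⟩ | ⟨-, -, h⟩
    · left; rw [hhalf e h]; norm_num
    · exact Or.inr h
    · left; rwa [← h]

/-- Replacing the alternating values along an odd cycle through an exposed vertex by `1/2`. -/
lemma IsBasicWith.add_cycle {a : V} {y : Sym2 V → ℝ} {F : Finset (Finset (Sym2 V))}
    (hy : IsBasicWith G y F) (ha : fracDeg y a = 0) {c : G.Walk a a} (hc : c.IsCycle)
    (hodd : Odd c.length) (hagree : ∀ e ∈ c.edges, y e = altCount c e) :
    ∃ y', IsBasicWith G y' (insert c.edges.toFinset F) ∧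
      (∀ u, fracDeg y' u = fracDeg y u + if u = a then 1 else 0) ∧
      ∀ e, 0 < y' e → 0 < y e ∨ e ∈ c.edges := by
  set y' : Sym2 V → ℝ := y + (1 / 2 : ℝ) • edgeCount c - altCount c with hy'
  have hval : ∀ e, e ∈ c.edges ∧ y' e = 1 / 2 ∧ (y e = 0 ∨ y e = 1)
      ∨ e ∉ c.edges ∧ y' e = y e := by
    intro e
    by_cases he : e ∈ c.edges
    · left
      refine ⟨he, ?_, ?_⟩
      · simp [hy', edgeCount_of_mem hc.isTrail he, hagree e he]
      · rw [hagree e he]; exact altCount_eq_zero_or_one hc.isTrail e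
    · right
      simp [hy', edgeCount_of_notMem he, altCount_of_notMem he, he]
  have hdeg : ∀ u, fracDeg y' u = fracDeg y u + if u = a then 1 else 0 := by
    intro u
    rw [hy', fracDeg_sub, fracDeg_add, fracDeg_smul, fracDeg_edgeCount,
      fracDeg_altCount, if_neg (Nat.not_even_iff_odd.2 hodd)]
    ring
  have hdisj : ∀ D ∈ F, Disjoint (edgeVerts D) (edgeVerts c.edges.toFinset) := by
    intro D hD
    rw [Set.disjoint_left]
    rintro u ⟨e, heD, hue⟩ huc
    rw [mem_edgeVerts_toFinset_iff hc.not_nil] at huc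
    have hye : y e = 1 / 2 := (hy.family.2.2 e).2 ⟨D, hD, heD⟩
    obtain ⟨t, rfl⟩ := Sym2.mem_iff_exists.1 hue
    have hua : u ≠ a := by
      rintro rfl
      rw [eq_zero_of_fracDeg_eq_zero hy.frac.1 ha t] at hye
      norm_num at hye
    have hec : s(u, t) ∉ c.edges := by
      intro h
      rcases altCount_eq_zero_or_one hc.isTrail s(u, t) with h' | h' <;>
        rw [hagree _ h, h'] at hye <;> norm_num at hye
    have hnn : ∀ e, 0 ≤ (y - altCount c) e := by
      intro e
      by_cases he : e ∈ c.edges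
      · simp [hagree e he]
      · simpa [altCount_of_notMem he] using hy.frac.1 e
    have h1 := le_fracDeg hnn u t
    rw [fracDeg_sub, fracDeg_altCount, if_neg hua, if_neg (Nat.not_even_iff_odd.2 hodd),
      Pi.sub_apply, hye, altCount_of_notMem hec] at h1
    have h2 : (1 : ℝ) ≤ c.support.count u := by
      exact_mod_cast List.count_pos_iff.2 huc
    linarith [hy.frac.fracDeg_le u]
  refine ⟨y', ⟨⟨fun e => ?_, fun e he => ?_, fun u => ?_⟩, fun e => ?_, ?_, ?_, fun e => ?_⟩,
    hdeg, fun e he => ?_⟩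
  · rcases hval e with ⟨-, h, -⟩ | ⟨-, h⟩ <;> rw [h]
    · norm_num
    · exact hy.frac.1 e
  · rcases hval e with ⟨h, -, -⟩ | ⟨-, h⟩
    · exact absurd (c.edges_subset_edgeSet h) he
    · rw [h, hy.frac.2.1 e he]
  · change fracDeg _ u ≤ 1
    rw [hdeg]
    split_ifs with h
    · subst h; rw [ha]; norm_num
    · linarith [hy.frac.fracDeg_le u]
  · rcases hval e with ⟨-, h, -⟩ | ⟨-, h⟩ <;> rw [h]
    · simp
    · exact hy.half e
  · intro D hD
    rcases Finset.mem_insert.1 hD with rfl | hD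
    · exact ⟨a, c, hc, hodd, rfl⟩
    · exact hy.family.1 D hD
  · intro D hD E hE hne
    rcases Finset.mem_insert.1 hD with rfl | hD <;> rcases Finset.mem_insert.1 hE with rfl | hE
    · exact absurd rfl hne
    · exact (hdisj E hE).symm
    · exact hdisj D hD
    · exact hy.family.2.1 D hD E hE hne
  · simp only [Finset.mem_insert, exists_eq_or_imp, List.mem_toFinset, ← hy.family.2.2]
    rcases hval e with ⟨he, h, -⟩ | ⟨he, h⟩ <;> simp [he, h]
  · rcases hval e with ⟨h, -, -⟩ | ⟨-, h⟩
    · exact Or.inr h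
    · left; rwa [← h]

/-- Closing an even path by an edge gives an odd cycle. -/
lemma isCycle_append_cons_nil {u a : V} {r : G.Walk u a} (hr : r.IsPath) (heven : Even r.length)
    (h : G.Adj a u) : (r.append (.cons h .nil)).IsCycle ∧ s(a, u) ∉ r.edges := by
  have he : s(a, u) ∉ r.edges := by
    intro he
    have := hr.length_eq_one_of_mem_edges (Sym2.eq_swap ▸ he)
    rw [this] at heven
    exact absurd heven (by decide)
  refine ⟨?_, he⟩
  rw [← SimpleGraph.Walk.isCycle_reverse, SimpleGraph.Walk.reverse_append]
  simp only [SimpleGraph.Walk.reverse_cons, SimpleGraph.Walk.reverse_nil,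
    SimpleGraph.Walk.nil_append, SimpleGraph.Walk.cons_append]
  rw [SimpleGraph.Walk.cons_isCycle_iff]
  refine ⟨hr.reverse, ?_⟩
  rw [SimpleGraph.Walk.edges_reverse, List.mem_reverse, Sym2.eq_swap]
  exact he

/-- The invariant of a search for an alternating path: the path flips `x`, lies in `T`, and each
of its edges outside `x` follows the permutation `τ`. -/
structure IsSearchPath {v a : V} (x : Sym2 V → ℝ) (T : Sym2 V → Prop) (τ : Equiv.Perm V)
    (p : G.Walk v a) : Prop where
  isFlipPath : IsFlipPath x p
  subset : ∀ e ∈ p.edges, T e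
  next : ∀ i, 2 * i + 1 ≤ p.length → p.getVert (2 * i + 1) = τ (p.getVert (2 * i))

section Search

variable {v a : V} {x : Sym2 V → ℝ} {T : Sym2 V → Prop} {τ : Equiv.Perm V} {p : G.Walk v a}
  {F : Finset (Finset (Sym2 V))}

lemma IsSearchPath.flip_support (hp : IsSearchPath x T τ p) (hT : ∀ e, 0 < x e → T e) {e : Sym2 V}
    (he : 0 < flip x p e) : T e := by
  by_cases h : e ∈ p.edges
  · exact hp.subset e h
  · rw [flip_of_notMem h] at he
    exact hT e he

lemma IsSearchPath.exists_cycle (hx : IsBasicWith G x F) (hv : fracDeg x v = 0)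
    (hp : IsSearchPath x T τ p) (hT : ∀ e, 0 < x e → T e) (hab : G.Adj a (τ a))
    (hTab : T s(a, τ a)) (hb : τ a ∈ p.support) :
    ∃ y F', IsBasicWith G y F' ∧ F'.card ≤ F.card + 1 ∧
      (∀ u, fracDeg y u = fracDeg x u + if u = v then 1 else 0) ∧ ∀ e, 0 < y e → T e := by
  obtain ⟨k, hk, hkl⟩ := SimpleGraph.Walk.mem_support_iff_exists_getVert.1 hb
  have hpath := hp.isFlipPath.isPath
  have hkeven : Even k := by
    by_contra hodd
    obtain ⟨i, rfl⟩ := Nat.not_even_iff_odd.1 hodd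
    rw [hp.next i hkl] at hk
    have h1 : p.getVert (2 * i) = p.getVert p.length := by
      rw [τ.injective hk, SimpleGraph.Walk.getVert_length]
    have h2 := hpath.getVert_injOn (by simp; omega) (by simp) h1
    omega
  have hT' := hpath.isTrail
  obtain ⟨q, r, hqr, hq⟩ : ∃ (q : G.Walk v (τ a)) (r : G.Walk (τ a) a),
      q.append r = p ∧ Even q.length := by
    refine hk ▸ ⟨p.take k, p.drop k, p.append_take_drop_eq k, ?_⟩
    rw [SimpleGraph.Walk.take_length, min_eq_left hkl]
    exact hkeven
  subst hqr
  have hr : Even r.length := by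
    have := hp.isFlipPath.even
    rw [SimpleGraph.Walk.length_append] at this
    exact (Nat.even_add.1 this).1 hq
  have halt : altCount (q.append r) = altCount q + altCount r := by
    rw [altCount_append, if_pos hq]
  have hdisj : ∀ e ∈ q.edges, e ∉ r.edges := by
    rw [SimpleGraph.Walk.isTrail_def, SimpleGraph.Walk.edges_append, List.nodup_append] at hT'
    exact fun e h1 h2 => hT'.2.2 e h1 e h2 rfl
  have hqflip : IsFlipPath x q := by
    refine ⟨hpath.of_append_left, hq, fun e he => ?_⟩
    rw [hp.isFlipPath.agree e (by simp [he]), halt, Pi.add_apply,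
      altCount_of_notMem (hdisj e he), add_zero]
  obtain ⟨hy, hyb⟩ := hx.flip hv hqflip
  obtain ⟨hc, he⟩ := isCycle_append_cons_nil hpath.of_append_right hr hab
  have hcalt : altCount (r.append (.cons hab .nil)) = altCount r := by
    rw [altCount_append, if_pos hr]
    ext e
    simp [altCount, edgeCount]
  obtain ⟨y', hy', hdeg, hsupp⟩ := hy.add_cycle hyb hc (by
      rw [SimpleGraph.Walk.length_append]
      exact hr.add_one) (by
    intro e hec
    rw [hcalt]
    rw [SimpleGraph.Walk.edges_append, List.mem_append] at hec
    rcases hec with hec | hec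
    · have := fun h => hdisj e h hec
      rw [flip_of_notMem this, hp.isFlipPath.agree e (by simp [hec]), halt, Pi.add_apply,
        altCount_of_notMem this, zero_add]
    · have hee : e = s(a, τ a) := by simpa using hec
      rw [hee, altCount_of_notMem he, Sym2.eq_swap]
      exact eq_zero_of_fracDeg_eq_zero hy.frac.1 hyb a)
  refine ⟨y', _, hy', Finset.card_insert_le _ _, fun u => ?_, fun e h => ?_⟩
  · rw [hdeg, fracDeg_flip hq]
    ring
  · rcases hsupp e h with h | h
    · by_cases heq : e ∈ q.edges
      · exact hp.subset e (by simp [heq])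
      · rw [flip_of_notMem heq] at h
        exact hT e h
    · rw [SimpleGraph.Walk.edges_append, List.mem_append] at h
      rcases h with h | h
      · exact hp.subset e (by simp [h])
      · have hee : e = s(a, τ a) := by simpa using h
        exact hee ▸ hTab

lemma IsSearchPath.extend (hx : IsBasicWith G x F) (hv : fracDeg x v = 0)
    (hp : IsSearchPath x T τ p) (hT : ∀ e, 0 < x e → T e) (hab : G.Adj a (τ a))
    (hTab : T s(a, τ a)) (hb : τ a ∉ p.support) {c : V} (hbc : x s(τ a, c) = 1) :
    ∃ q : G.Walk v c, q.length = p.length + 2 ∧ IsSearchPath x T τ q := by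
  have hadj : G.Adj (τ a) c := by
    by_contra h
    rw [hx.frac.2.1 _ h] at hbc
    norm_num at hbc
  have hbcp : s(τ a, c) ∉ p.edges := fun h => hb (p.fst_mem_support_of_mem_edges h)
  have habp : s(a, τ a) ∉ p.edges := fun h => hb (p.snd_mem_support_of_mem_edges h)
  have hc : c ∉ p.support := by
    intro hc
    have hcv : c ≠ v := by
      rintro rfl
      rw [Sym2.eq_swap, eq_zero_of_fracDeg_eq_zero hx.frac.1 hv] at hbc
      norm_num at hbc
    have hnn : ∀ e, 0 ≤ (x - altCount p) e := by
      intro e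
      by_cases he : e ∈ p.edges
      · simp [hp.isFlipPath.agree e he]
      · simpa [altCount_of_notMem he] using hx.frac.1 e
    have h1 := le_fracDeg hnn c (τ a)
    rw [Sym2.eq_swap, fracDeg_sub, fracDeg_altCount, if_neg hcv, if_pos hp.isFlipPath.even,
      Pi.sub_apply, hbc, altCount_of_notMem hbcp] at h1
    have h2 : (1 : ℝ) ≤ p.support.count c := by
      exact_mod_cast List.count_pos_iff.2 hc
    linarith [hx.frac.fracDeg_le c]
  have hca : c ≠ a := by rintro rfl; exact hc p.end_mem_support
  have hxab : x s(a, τ a) = 0 := by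
    have h1 : x s(τ a, a) + x s(τ a, c) ≤ fracDeg x (τ a) := by
      rw [fracDeg, ← Finset.sum_pair (f := fun b => x s(τ a, b)) hca.symm]
      exact Finset.sum_le_sum_of_subset_of_nonneg (Finset.subset_univ _)
        fun b _ _ => hx.frac.1 _
    rw [Sym2.eq_swap]
    linarith [hx.frac.fracDeg_le (τ a), hx.frac.1 s(τ a, a)]
  have hne : s(a, τ a) ≠ s(τ a, c) := by
    intro h
    rw [h, hbc] at hxab
    norm_num at hxab
  have heven := hp.isFlipPath.even
  set q : G.Walk v c := p.append (.cons hab (.cons hadj .nil)) with hq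
  have hlen : q.length = p.length + 2 := by simp [hq]
  have hedges : ∀ e, e ∈ q.edges ↔ e ∈ p.edges ∨ e = s(a, τ a) ∨ e = s(τ a, c) := by
    intro e; simp [hq]
  have halt : altCount q = altCount p + Pi.single s(τ a, c) 1 := by
    rw [hq, altCount_append, if_pos heven]
    ext e
    simp [altCount, edgeCount_cons]
  refine ⟨q, hlen, ⟨?_, ?_, fun e he => ?_⟩, fun e he => ?_, fun i hi => ?_⟩
  · have h1 : (p.concat hab).IsPath := hp.isFlipPath.isPath.concat hb hab
    have h2 : ((p.concat hab).concat hadj).IsPath := h1.concat (by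
      simp [SimpleGraph.Walk.support_concat, hc, hadj.ne']) hadj
    simpa [hq, SimpleGraph.Walk.concat_eq_append, ← SimpleGraph.Walk.append_assoc] using h2
  · rw [hlen]; exact heven.add even_two
  · rw [halt, Pi.add_apply]
    rcases (hedges e).1 he with h | rfl | rfl
    · rw [hp.isFlipPath.agree e h, Pi.single_eq_of_ne (by rintro rfl; exact hbcp h), add_zero]
    · rw [hxab, altCount_of_notMem habp, Pi.single_eq_of_ne hne, add_zero]
    · rw [hbc, altCount_of_notMem hbcp, Pi.single_eq_same, zero_add]
  · rcases (hedges e).1 he with h | rfl | rfl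
    · exact hp.subset e h
    · exact hTab
    · exact hT _ (by rw [hbc]; norm_num)
  · rw [hlen] at hi
    have hlt : ∀ j < p.length, q.getVert j = p.getVert j := fun j hj => by
      rw [hq, SimpleGraph.Walk.getVert_append, if_pos hj]
    have h0 : q.getVert p.length = a := by
      rw [hq, SimpleGraph.Walk.getVert_append, if_neg (lt_irrefl _)]
      simp
    have h1 : q.getVert (p.length + 1) = τ a := by
      rw [hq, SimpleGraph.Walk.getVert_append, if_neg (by omega)]
      simp
    obtain ⟨m, hm⟩ := heven
    rcases Nat.lt_or_ge (2 * i + 1) p.length with h | h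
    · rw [hlt _ h, hlt _ (by omega), hp.next i h.le]
    · have : 2 * i = p.length := by omega
      rw [this, h1, h0]

/-- An alternating search from the exposed vertex `v` yields a basic fractional matching that
saturates `v`, using at most one additional odd cycle. -/
lemma IsSearchPath.exists_saturating {S : V → Prop} (hx : IsBasicWith G x F)
    (hv : fracDeg x v = 0) (hT : ∀ e, 0 < x e → T e)
    (hτT : ∀ u, G.Adj u (τ u) → T s(u, τ u)) (hτS : ∀ u, ¬ G.Adj u (τ u) → S u)
    (hS : ∀ u, fracDeg x u < 1 → S u) (hτv : G.Adj v (τ v)) (hp : IsSearchPath x T τ p) :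
    ∃ y F', IsBasicWith G y F' ∧ F'.card ≤ F.card + 1 ∧ fracDeg y v = 1 ∧
      (∀ e, 0 < y e → T e) ∧ ∀ u, fracDeg y u < 1 → S u := by
  induction hn : Fintype.card V - p.length using Nat.strong_induction_on generalizing a with
  | _ n ih =>
  have finish : ∀ y : Sym2 V → ℝ, (∀ u, fracDeg x u + (if u = v then 1 else 0) ≤ fracDeg y u) →
      ∀ u, fracDeg y u < 1 → S u := fun y h u hu => hS u (by
    have := h u
    split_ifs at this <;> linarith)
  obtain ⟨hy, hya⟩ := hx.flip hv hp.isFlipPath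
  have hdeg := fracDeg_flip (x := x) hp.isFlipPath.even
  by_cases hab : G.Adj a (τ a)
  swap
  · have hva : v ≠ a := by rintro rfl; exact hab hτv
    refine ⟨_, F, hy, by omega, by simp [hdeg, hv, hva], fun e => hp.flip_support hT,
      fun u hu => ?_⟩
    by_cases hua : u = a
    · subst hua; exact hτS u hab
    · refine hS u ?_
      rw [hdeg, if_neg hua] at hu
      split_ifs at hu <;> linarith
  have hTab := hτT a hab
  by_cases hb : τ a ∈ p.support
  · obtain ⟨y, F', hy', hcard, hd, hs⟩ := hp.exists_cycle hx hv hT hab hTab hb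
    exact ⟨y, F', hy', hcard, by simp [hd, hv], hs, finish y fun u => (hd u).ge⟩
  by_cases hb1 : ∃ c, x s(τ a, c) = 1
  · obtain ⟨c, hc⟩ := hb1
    obtain ⟨q, hql, hq⟩ := hp.extend hx hv hT hab hTab hb hc
    have := hq.isFlipPath.isPath.length_lt
    exact ih _ (by omega) hq rfl
  by_cases hb2 : ∃ c, x s(τ a, c) = 1 / 2
  · obtain ⟨c, hc⟩ := hb2
    obtain ⟨C, hC, hbC⟩ := (hx.family.2.2 _).1 hc
    obtain ⟨y, hy', hd, hs⟩ := hy.round_cycle hya hab hC ⟨_, hbC, by simp⟩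
    refine ⟨y, _, hy', (Finset.card_erase_le).trans (Nat.le_succ _), ?_, fun e he => ?_,
      finish y fun u => ?_⟩
    · rw [hd, hdeg, hv]; simp
    · rcases hs e he with h | rfl
      · exact hp.flip_support hT h
      · exact hTab
    · rw [hd, hdeg]; linarith
  · have hxb : fracDeg x (τ a) = 0 := Finset.sum_eq_zero fun c _ => by
      rcases hx.half s(τ a, c) with h | h | h
      · exact h
      · exact absurd ⟨c, h⟩ hb2
      · exact absurd ⟨c, h⟩ hb1
    have hbv : τ a ≠ v := by rintro h; exact hb (h ▸ p.start_mem_support)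
    have hyb : fracDeg (flip x p) (τ a) = 0 := by
      rw [hdeg, hxb, if_neg hbv, if_neg hab.ne']; norm_num
    have hd : ∀ u, fracDeg (flip x p + Pi.single s(a, τ a) 1) u
        = fracDeg x u + (if u = v then 1 else 0) + if u = τ a then 1 else 0 := fun u => by
      rw [fracDeg_add, fracDeg_single hab.ne, hdeg]; ring
    refine ⟨_, F, hy.add_edge hya hyb hab, by omega, ?_, fun e he => ?_, finish _ fun u => ?_⟩
    · rw [hd, hv]; simp [hbv.symm]
    · by_cases hee : e = s(a, τ a)
      · exact hee ▸ hTab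
      · rw [Pi.add_apply, Pi.single_eq_of_ne hee, add_zero] at he
        exact hp.flip_support hT he
    · rw [hd]; split_ifs <;> linarith

end Search

lemma IsBasicWith.mono {H : SimpleGraph V} (h : H ≤ G) {x : Sym2 V → ℝ}
    {F : Finset (Finset (Sym2 V))} (hx : IsBasicWith H x F) : IsBasicWith G x F := by
  refine ⟨hx.frac.mono h, hx.half, fun C hC => ?_, hx.family.2⟩
  obtain ⟨u, c, hc, hodd, rfl⟩ := hx.family.1 C hC
  exact ⟨u, c.mapLe h, hc.mapLe h, by simpa using hodd, by simp⟩

/-- Adding a vertex to a graph increases the number of odd cycles by at most one. -/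
lemma exists_isBasicWith_of_deleteVerts {w : Sym2 V → ℝ} {v : V} {x : Sym2 V → ℝ}
    {F : Finset (Finset (Sym2 V))} (hmax : IsMaxFracMatching (deleteVerts G {v}) w x)
    (hx : IsBasicWith (deleteVerts G {v}) x F) :
    ∃ y F', IsMaxFracMatching G w y ∧ IsBasicWith G y F' ∧ F'.card ≤ F.card + 1 := by
  obtain ⟨σ, hz⟩ := exists_permFrac_isMax G w
  rcases isMax_or_fracDeg_eq_one hmax hz with h | h
  · exact ⟨x, F, h, hx.mono (deleteVerts_le _), Nat.le_succ _⟩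
  have hσv : G.Adj v (σ v) := by
    by_contra hn
    have := fracDeg_permFrac_le_half hn
    rw [h] at this
    norm_num at this
  have hnil : IsSearchPath (G := G) x (fun e => 0 < x e ∨ 0 < permFrac G σ e) σ
      (.nil : G.Walk v v) := ⟨⟨.nil, by simp, by simp⟩, by simp, by simp⟩
  obtain ⟨y, F', hy, hcard, hyv, hsupp, hslack⟩ := hnil.exists_saturating
    (S := fun u => fracDeg x u < 1 ∨ fracDeg (permFrac G σ) u < 1)
    (T := fun e => 0 < x e ∨ 0 < permFrac G σ e) (τ := σ)
    (hx.mono (deleteVerts_le _)) (fracDeg_deleteVerts hx.frac) (fun _ => Or.inl)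
    (fun _ hu => Or.inr (permFrac_pos hu))
    (fun _ hu => Or.inr ((fracDeg_permFrac_le_half hu).trans_lt (by norm_num)))
    (fun _ => Or.inl) hσv
  exact ⟨y, F', isMax_of_support hmax hz hy.frac hyv hsupp hslack, hy, hcard⟩

/-- Every weighted graph has a basic maximum-weight fractional matching. -/
lemma exists_isMax_isBasicWith (G : SimpleGraph V) (w : Sym2 V → ℝ) :
    ∃ x F, IsMaxFracMatching G w x ∧ IsBasicWith G x F := by
  have key : ∀ A : Finset V, ∃ x F, IsMaxFracMatching (deleteVerts G (↑A)ᶜ) w x ∧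
      IsBasicWith (deleteVerts G (↑A)ᶜ) x F := by
    intro A
    induction A using Finset.induction_on with
    | empty =>
      have hedge : ∀ e, e ∉ (deleteVerts G (↑(∅ : Finset V))ᶜ).edgeSet := by
        intro e
        induction e with | _ a b
        simp [deleteVerts]
      have h0 : IsFracMatching (deleteVerts G (↑(∅ : Finset V))ᶜ) 0 := by
        simp [IsFracMatching]
      refine ⟨0, ∅, ⟨h0, fun y hy => ?_⟩, h0, fun e => Or.inl rfl, by simp, by simp, by simp⟩
      rw [show y = 0 from funext fun e => hy.2.1 e (hedge e)]
    | insert v A hvA ih =>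
      have hdel : deleteVerts (deleteVerts G (↑(insert v A))ᶜ) {v} = deleteVerts G (↑A)ᶜ := by
        ext a b
        simp only [deleteVerts, Finset.coe_insert, Set.mem_compl_iff, Set.mem_insert_iff,
          Finset.mem_coe, Set.mem_singleton_iff, not_not]
        grind
      obtain ⟨x, F, hmax, hx⟩ := ih
      rw [← hdel] at hmax hx
      obtain ⟨y, F', hy, hy', -⟩ := exists_isBasicWith_of_deleteVerts hmax hx
      exact ⟨y, F', hy, hy'⟩
  have huniv : deleteVerts G (↑(Finset.univ : Finset V))ᶜ = G := by
    ext a b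
    simp [deleteVerts]
  simpa only [huniv] using key Finset.univ

/-- deleting a vertex decreases γ by at most one: γ(G∖v) ≥ γ(G) − 1. -/
theorem gamma_deleteVert
    {V : Type*} [Fintype V] [DecidableEq V]
    (G : SimpleGraph V) (w : Sym2 V → ℝ) (hw : ∀ e, 0 ≤ w e) (v : V) :
    gamma G w - 1 ≤ gamma (deleteVerts G {v}) w := by
  obtain ⟨x₀, F₀, hmax₀, hx₀⟩ := exists_isMax_isBasicWith (deleteVerts G {v}) w
  obtain ⟨x, F, hmax, hhalf, hfam, hcard⟩ := Nat.sInf_mem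
    (s := {n : ℕ | ∃ (x : Sym2 V → ℝ) (F : Finset (Finset (Sym2 V))),
      IsMaxFracMatching (deleteVerts G {v}) w x ∧ IsHalfIntegral x ∧
        IsCycleFamily (deleteVerts G {v}) x F ∧ F.card = n})
    ⟨_, x₀, F₀, hmax₀, hx₀.half, hx₀.family, rfl⟩
  obtain ⟨y, F', hy, hy', hle⟩ :=
    exists_isBasicWith_of_deleteVerts hmax ⟨hmax.1, hhalf, hfam⟩
  have hG : gamma G w ≤ F'.card := Nat.sInf_le ⟨y, F', hy, hy'.half, hy'.family, rfl⟩
  rw [Nat.sub_le_iff_le_add]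
  exact hG.trans (hle.trans_eq (congrArg (· + 1) hcard))

end Stabilizer
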